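/- arXiv:1105.6266 — 2 statements merged into one kernel-verified Lean document; each statement's English description precedes it below -/
import Mathlib

section
/- Let N > d > 0 and let f = (f₁, …, f_{N−d}) : ℂ^N → ℂ^{N−d} be a polynomial map whose image is Zariski dense in ℂ^{N−d}, i.e., the only polynomial q on ℂ^{N−d} with q(f(x)) = 0 for all x ∈ ℂ^N is the zero polynomial. Then there exists a nonzero polynomial p in N − d variables over ℂ such that for every z ∈ ℂ^{N−d} with p(z) ≠ 0: (i) the fiber {x ∈ ℂ^N : f(x) = z} is nonempty, and (ii) at every point x of this fiber the derivative Df(x) : ℂ^N → ℂ^{N−d} (given by the Jacobian matrix of f at x) is surjective; consequently {x : f(x) = z} is a smooth complex submanifold of ℂ^N of dimension d. -/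
open MvPolynomial

theorem aux_formallySmooth (A K : Type) [CommRing A] [IsDomain A] [CharZero A] [Field K]
    [Algebra A K] [FaithfulSMul A K] [Algebra.EssFiniteType A K] :
    Algebra.FormallySmooth A K := by
  let : Algebra (FractionRing A) K := FractionRing.liftAlgebra A K
  have : IsScalarTower A (FractionRing A) K := FractionRing.isScalarTower_liftAlgebra A K
  have : CharZero (FractionRing A) :=
    charZero_of_injective_algebraMap (IsFractionRing.injective A (FractionRing A))
  have : Algebra.EssFiniteType (FractionRing A) K := Algebra.EssFiniteType.of_comp A _ K
  have : Algebra.FormallySmooth (FractionRing A) K := inferInstance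
  have : Algebra.FormallySmooth A (FractionRing A) :=
    Algebra.FormallySmooth.of_isLocalization (nonZeroDivisors A)
  exact Algebra.FormallySmooth.comp A (FractionRing A) K

/-- The chain rule for ring homomorphisms into the dual numbers. -/
theorem aux_chain {N : ℕ} {K : Type} [Field K] [Algebra ℂ K]
    (π : MvPolynomial (Fin N) ℂ →ₐ[ℂ] K)
    (ψ : MvPolynomial (Fin N) ℂ →ₐ[ℂ] TrivSqZeroExt K K)
    (h : ∀ b, (ψ b).fst = π b) (b : MvPolynomial (Fin N) ℂ) :
    (ψ b).snd = ∑ j, π (pderiv j b) * (ψ (X j)).snd := by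
  induction b using MvPolynomial.induction_on with
  | C a =>
    rw [← MvPolynomial.algebraMap_eq, ψ.commutes]
    simp [TrivSqZeroExt.algebraMap_eq_inl']
  | add p q hp hq =>
    simp [hp, hq, add_mul, Finset.sum_add_distrib]
  | mul_X p i hp =>
    simp only [map_mul, TrivSqZeroExt.snd_mul, h, hp, Derivation.leibniz, pderiv_X, map_add,
      smul_eq_mul, add_mul, Finset.sum_add_distrib, MulOpposite.smul_eq_mul_unop,
      MulOpposite.unop_op]
    congr 1
    · rw [Finset.sum_eq_single i]
      · simp
      · intro j _ hj
        simp [hj.symm]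
      · simp
    · rw [Finset.sum_mul]
      refine Finset.sum_congr rfl fun j _ => ?_
      ring

theorem aux_key {n N : ℕ} (f : Fin n → MvPolynomial (Fin N) ℂ) {K : Type} [Field K]
    [Algebra ℂ K] [Algebra.EssFiniteType ℂ K] (π : MvPolynomial (Fin N) ℂ →ₐ[ℂ] K)
    (hinj : Function.Injective (π.comp (aeval f))) :
    ∃ M : Matrix (Fin N) (Fin n) K,
      (Matrix.of fun (i : Fin n) (j : Fin N) => π (pderiv j (f i))) * M = 1 := by
  let : Algebra (MvPolynomial (Fin n) ℂ) K := (π.comp (aeval f)).toRingHom.toAlgebra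
  have halg : ∀ a, algebraMap (MvPolynomial (Fin n) ℂ) K a = π (aeval f a) := fun _ => rfl
  have : IsScalarTower ℂ (MvPolynomial (Fin n) ℂ) K :=
    IsScalarTower.of_algebraMap_eq' (π.comp (aeval f)).comp_algebraMap.symm
  have : FaithfulSMul (MvPolynomial (Fin n) ℂ) K := (faithfulSMul_iff_algebraMap_injective _ _).2 hinj
  have : Algebra.EssFiniteType (MvPolynomial (Fin n) ℂ) K := Algebra.EssFiniteType.of_comp ℂ _ K
  have := aux_formallySmooth (MvPolynomial (Fin n) ℂ) K
  have main : ∀ i : Fin n, ∃ m : Fin N → K, ∀ k : Fin n,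
      ∑ j, π (pderiv j (f k)) * m j = if k = i then 1 else 0 := by
    intro i
    let e : MvPolynomial (Fin n) ℂ →ₐ[ℂ] TrivSqZeroExt K K :=
      aeval fun k => TrivSqZeroExt.inl (π (f k)) + TrivSqZeroExt.inr (if k = i then 1 else 0)
    let : Algebra (MvPolynomial (Fin n) ℂ) (TrivSqZeroExt K K) := e.toRingHom.toAlgebra
    have healg : ∀ a, algebraMap (MvPolynomial (Fin n) ℂ) (TrivSqZeroExt K K) a = e a :=
      fun _ => rfl
    have hfe : ∀ a, (e a).fst = π (aeval f a) := by
      intro a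
      have : (TrivSqZeroExt.fstHom ℂ K K).comp e = π.comp (aeval f) := by
        ext k
        by_cases hk : k = i <;> simp [e, hk]
      exact DFunLike.congr_fun this a
    let g : TrivSqZeroExt K K →ₐ[MvPolynomial (Fin n) ℂ] K :=
      { (TrivSqZeroExt.fstHom ℂ K K).toRingHom with
        commutes' := fun a => hfe a }
    have hg : ∀ x, g x = x.fst := fun _ => rfl
    have hgs : Function.Surjective g := fun x => ⟨TrivSqZeroExt.inl x, by simp [hg]⟩
    have hnil : IsNilpotent (RingHom.ker (g : TrivSqZeroExt K K →+* K)) := by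
      refine ⟨2, ?_⟩
      rw [Ideal.zero_eq_bot, eq_bot_iff]
      refine (pow_two (RingHom.ker (g : TrivSqZeroExt K K →+* K))).le.trans ?_
      rw [Ideal.mul_le]
      intro r hr s hs
      have hr' : r.fst = 0 := hr
      have hs' : s.fst = 0 := hs
      rw [Ideal.mem_bot]
      ext <;> simp [hr', hs']
    let h := Algebra.FormallySmooth.liftOfSurjective (AlgHom.id _ K) g hgs hnil
    have hh : ∀ x, (h x).fst = x := fun x =>
      Algebra.FormallySmooth.liftOfSurjective_apply (AlgHom.id _ K) g hgs hnil x
    have hC : ∀ c : ℂ, h (algebraMap ℂ K c) = algebraMap ℂ (TrivSqZeroExt K K) c := by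
      intro c
      rw [IsScalarTower.algebraMap_apply ℂ (MvPolynomial (Fin n) ℂ) K, h.commutes, healg,
        e.commutes]
    let ψ : MvPolynomial (Fin N) ℂ →ₐ[ℂ] TrivSqZeroExt K K :=
      { h.toRingHom.comp π.toRingHom with
        commutes' := fun c => by
          change h (π (algebraMap ℂ _ c)) = _
          rw [π.commutes, hC] }
    have hψ : ∀ b, ψ b = h (π b) := fun _ => rfl
    refine ⟨fun j => (ψ (X j)).snd, fun k => ?_⟩
    rw [← aux_chain π ψ (fun b => by rw [hψ, hh]) (f k), hψ]
    have : π (f k) = algebraMap (MvPolynomial (Fin n) ℂ) K (X k) := by rw [halg, aeval_X]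
    rw [this, h.commutes, healg]
    by_cases hk : k = i <;> simp [e, hk]
  choose m hm using main
  refine ⟨Matrix.of fun j i => m i j, ?_⟩
  ext k i
  simp [Matrix.mul_apply, hm, Matrix.one_apply]

theorem aux_eval {n N : ℕ} (f : Fin n → MvPolynomial (Fin N) ℂ) (q : MvPolynomial (Fin n) ℂ)
    (x : Fin N → ℂ) : eval x (aeval f q) = eval (fun i => eval x (f i)) q := by
  induction q using MvPolynomial.induction_on with
  | C a => simp
  | add p q hp hq => rw [map_add, map_add, map_add, hp, hq]
  | mul_X p i hp => rw [map_mul, map_mul, map_mul, hp, aeval_X, eval_X]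

theorem aux_noncrit {n N : ℕ} (f : Fin n → MvPolynomial (Fin N) ℂ)
    (hinj : Function.Injective (aeval f : MvPolynomial (Fin n) ℂ →ₐ[ℂ] MvPolynomial (Fin N) ℂ)) :
    ∃ p : MvPolynomial (Fin n) ℂ, p ≠ 0 ∧
      ∀ x : Fin N → ℂ, eval (fun i => eval x (f i)) p ≠ 0 →
          Function.Surjective
            (Matrix.mulVec
              (Matrix.of fun (i : Fin n) (j : Fin N) => eval x (pderiv j (f i)))) := by
  classical
  let J : Matrix (Fin n) (Fin N) (MvPolynomial (Fin N) ℂ) := Matrix.of fun i j => pderiv j (f i)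
  let I : Ideal (MvPolynomial (Fin N) ℂ) :=
    Ideal.span (Set.range fun M : Matrix (Fin N) (Fin n) (MvPolynomial (Fin N) ℂ) => (J * M).det)
  have hI : ∀ x : Fin N → ℂ, ∀ b ∈ I, eval x b ≠ 0 → Function.Surjective
            (Matrix.mulVec
              (Matrix.of fun (i : Fin n) (j : Fin N) => eval x (pderiv j (f i)))) := by
    intro x b hb hne
    by_contra hns
    apply hne
    have : I ≤ RingHom.ker (eval x) := by
      refine Ideal.span_le.2 ?_
      rintro _ ⟨M, rfl⟩
      change eval x (J * M).det = 0
      by_contra hdet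
      apply hns
      rw [RingHom.map_det, RingHom.mapMatrix_apply, Matrix.map_mul] at hdet
      intro y
      refine ⟨Matrix.mulVec (M.map (eval x))
        (Matrix.mulVec ((J.map (eval x) * M.map (eval x))⁻¹) y), ?_⟩
      change Matrix.mulVec (J.map (eval x)) _ = y
      rw [Matrix.mulVec_mulVec, Matrix.mulVec_mulVec,
        Matrix.mul_nonsing_inv _ (isUnit_iff_ne_zero.2 hdet), Matrix.one_mulVec]
    exact this hb
  by_contra! hcon
  let S : Submonoid (MvPolynomial (Fin N) ℂ) :=
    (nonZeroDivisors (MvPolynomial (Fin n) ℂ)).map (aeval f : MvPolynomial (Fin n) ℂ →ₐ[ℂ] MvPolynomial (Fin N) ℂ)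
  have hdisj : Disjoint (I : Set (MvPolynomial (Fin N) ℂ)) S := by
    rw [Set.disjoint_left]
    rintro _ hb ⟨p, hp, rfl⟩
    obtain ⟨x, hx, hns⟩ := hcon p (nonZeroDivisors.ne_zero hp)
    refine hns (hI x _ hb ?_)
    convert hx using 1
    exact aux_eval f p x
  obtain ⟨P, hP, hIP, hPS⟩ := Ideal.exists_le_prime_disjoint I S hdisj
  let K := FractionRing (MvPolynomial (Fin N) ℂ ⧸ P)
  have : Algebra.EssFiniteType (MvPolynomial (Fin N) ℂ ⧸ P) K :=
    Algebra.EssFiniteType.of_isLocalization K (nonZeroDivisors (MvPolynomial (Fin N) ℂ ⧸ P))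
  have : Algebra.EssFiniteType ℂ K := Algebra.EssFiniteType.comp ℂ (MvPolynomial (Fin N) ℂ ⧸ P) K
  let π : MvPolynomial (Fin N) ℂ →ₐ[ℂ] K :=
    (IsScalarTower.toAlgHom ℂ (MvPolynomial (Fin N) ℂ ⧸ P) K).comp (Ideal.Quotient.mkₐ ℂ P)
  have hπ : ∀ b, π b = algebraMap _ K (Ideal.Quotient.mk P b) := fun _ => rfl
  have hπ0 : ∀ b, π b = 0 ↔ b ∈ P := by
    intro b
    rw [hπ, FaithfulSMul.algebraMap_eq_zero_iff, Ideal.Quotient.eq_zero_iff_mem]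
  obtain ⟨M, hM⟩ := aux_key f π (by
    rw [injective_iff_map_eq_zero]
    intro a ha
    by_contra hne
    exact Set.disjoint_left.1 hPS ((hπ0 _).1 ha) ⟨a, mem_nonZeroDivisors_of_ne_zero hne, rfl⟩)
  obtain ⟨⟨g, hg⟩, hgM⟩ := IsLocalization.exist_integer_multiples_of_finset
    (nonZeroDivisors (MvPolynomial (Fin N) ℂ ⧸ P))
    (Finset.univ.image fun ij : Fin N × Fin n => M ij.1 ij.2)
  obtain ⟨g, rfl⟩ := Ideal.Quotient.mk_surjective g
  have hex : ∀ j i, ∃ b, π b = π g * M j i := by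
    intro j i
    obtain ⟨b, hb⟩ := hgM (M j i) (Finset.mem_image.2 ⟨(j, i), Finset.mem_univ _, rfl⟩)
    obtain ⟨b, rfl⟩ := Ideal.Quotient.mk_surjective b
    refine ⟨b, ?_⟩
    rw [hπ, hb, hπ, Algebra.smul_def]
  choose M' hM' using hex
  have hdet : π (J * Matrix.of M').det = 0 := (hπ0 _).2 (hIP (Ideal.subset_span ⟨_, rfl⟩))
  have hmat : (J * Matrix.of M').map π = π g • (1 : Matrix (Fin n) (Fin n) K) := by
    rw [← hM, Matrix.map_mul, ← Matrix.mul_smul]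
    congr 1
    ext j i
    simp [hM']
  have h2 : π (J * Matrix.of M').det = (π g) ^ n := by
    have := AlgHom.map_det π (J * Matrix.of M')
    rw [this, AlgHom.mapMatrix_apply, hmat]
    simp
  rw [h2] at hdet
  have := (hπ0 g).1 (by
    by_contra hne
    exact pow_ne_zero n hne hdet)
  exact nonZeroDivisors.ne_zero hg (Ideal.Quotient.eq_zero_iff_mem.2 this)

theorem aux_nonempty {n N : ℕ} (f : Fin n → MvPolynomial (Fin N) ℂ)
    (hinj : Function.Injective (aeval f : MvPolynomial (Fin n) ℂ →ₐ[ℂ] MvPolynomial (Fin N) ℂ)) :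
    ∃ p : MvPolynomial (Fin n) ℂ, p ≠ 0 ∧
      ∀ z : Fin n → ℂ, eval z p ≠ 0 → ∃ x : Fin N → ℂ, ∀ i, eval x (f i) = z i := by
  let φ : MvPolynomial (Fin n) ℂ →ₐ[ℂ] MvPolynomial (Fin N) ℂ := aeval f
  have hfp : φ.toRingHom.FinitePresentation := by
    refine RingHom.FinitePresentation.of_finiteType.1 ?_
    refine RingHom.FiniteType.of_comp_finiteType (f := algebraMap ℂ (MvPolynomial (Fin n) ℂ)) ?_
    have : φ.toRingHom.comp (algebraMap ℂ _) = algebraMap ℂ _ := φ.comp_algebraMap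
    rw [this, RingHom.finiteType_algebraMap]
    infer_instance
  obtain ⟨T, hT⟩ := PrimeSpectrum.exists_constructibleSetData_iff.2
    (PrimeSpectrum.isConstructible_range_comap hfp)
  have hbot : (⊥ : PrimeSpectrum (MvPolynomial (Fin n) ℂ)) ∈ T.toSet := by
    rw [hT]
    refine ⟨⊥, ?_⟩
    ext a
    simpa using map_eq_zero_iff φ hinj
  simp only [PrimeSpectrum.ConstructibleSetData.toSet, Set.mem_iUnion] at hbot
  obtain ⟨C, hCT, hC, hCf⟩ := hbot
  have hg : ∀ i, C.g i = 0 := fun i => by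
    have := hC ⟨i, rfl⟩
    simpa using this
  refine ⟨C.f, fun h => hCf (by simp [h]), fun z hz => ?_⟩
  let m : PrimeSpectrum (MvPolynomial (Fin n) ℂ) := ⟨RingHom.ker (eval z), RingHom.ker_isPrime _⟩
  have hm : m ∈ T.toSet := by
    simp only [PrimeSpectrum.ConstructibleSetData.toSet, Set.mem_iUnion]
    refine ⟨C, hCT, ?_, ?_⟩
    · rintro _ ⟨i, rfl⟩
      simp [hg]
    · intro h
      exact hz (h rfl)
  rw [hT] at hm
  obtain ⟨Q, hQ⟩ := hm
  obtain ⟨Mx, hMx, hQM⟩ := Ideal.exists_le_maximal Q.asIdeal Q.isPrime.ne_top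
  obtain ⟨x, rfl⟩ := (MvPolynomial.isMaximal_iff_eq_vanishingIdeal_singleton).1 hMx
  refine ⟨x, fun i => ?_⟩
  have h1 : (X i - MvPolynomial.C (z i) : MvPolynomial (Fin n) ℂ) ∈ m.asIdeal := by
    change eval z _ = 0
    simp
  rw [← hQ] at h1
  have h2 := (mem_vanishingIdeal_singleton_iff _ _).1 (hQM h1)
  have h3 : φ (X i - MvPolynomial.C (z i)) = f i - MvPolynomial.C (z i) := by simp [φ]
  change aeval x (φ _) = 0 at h2
  rw [h3] at h2
  simpa [sub_eq_zero, coe_aeval_eq_eval] using h2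

/-- If `f = (f₁, …, f_{N-d}) : ℂ^N → ℂ^{N-d}` is a polynomial map with Zariski dense
image, then there is a nonzero polynomial `p` in `N - d` variables such that for
every `z` with `p(z) ≠ 0`, the fiber `{x : f(x) = z}` is nonempty and at every point
of this fiber the Jacobian-induced linear map `Df(x) : ℂ^N → ℂ^{N-d}` is surjective
(hence the fiber is a smooth `d`-dimensional complex submanifold of `ℂ^N`). -/
theorem generic_fiber_nonempty_and_smooth (N d : ℕ) (hd : 0 < d) (hN : d < N)
    (f : Fin (N - d) → MvPolynomial (Fin N) ℂ)
    (hdense : ∀ q : MvPolynomial (Fin (N - d)) ℂ,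
      (∀ x : Fin N → ℂ, eval (fun i => eval x (f i)) q = 0) → q = 0) :
    ∃ p : MvPolynomial (Fin (N - d)) ℂ, p ≠ 0 ∧
      ∀ z : Fin (N - d) → ℂ, eval z p ≠ 0 →
        (∃ x : Fin N → ℂ, ∀ i : Fin (N - d), eval x (f i) = z i) ∧
        (∀ x : Fin N → ℂ, (∀ i : Fin (N - d), eval x (f i) = z i) →
          Function.Surjective
            (Matrix.mulVec
              (Matrix.of fun (i : Fin (N - d)) (j : Fin N) => eval x (pderiv j (f i))))) := by
  have hev : ∀ (q : MvPolynomial (Fin (N - d)) ℂ) (x : Fin N → ℂ),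
      eval x (aeval f q) = eval (fun i => eval x (f i)) q := aux_eval f
  have hinj : Function.Injective
      (aeval f : MvPolynomial (Fin (N - d)) ℂ →ₐ[ℂ] MvPolynomial (Fin N) ℂ) := by
    rw [injective_iff_map_eq_zero]
    intro q hq
    refine hdense q fun x => ?_
    rw [← hev, hq, map_zero]
  obtain ⟨p₁, hp₁, h₁⟩ := aux_nonempty f hinj
  obtain ⟨p₂, hp₂, h₂⟩ := aux_noncrit f hinj
  refine ⟨p₁ * p₂, mul_ne_zero hp₁ hp₂, fun z hz => ?_⟩
  rw [map_mul] at hz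
  refine ⟨h₁ z (left_ne_zero_of_mul hz), fun x hx => h₂ x ?_⟩
  rw [funext hx]
  exact right_ne_zero_of_mul hz
end

section
/- Let Z = {(x, y) ∈ ℝ² : y² = x²(x − 1)}. Then (0, 0) ∈ Z, the singleton {(0, 0)} is a connected component of Z, and Z \ {(0, 0)} is nonempty and connected, hence is also a connected component of Z. In particular, Z has exactly two connected components, {(0, 0)} and Z \ {(0, 0)}, so Z is not connected. -/
theorem nodal_aux_ge {p : ℝ × ℝ} (hp : p.2 ^ 2 = p.1 ^ 2 * (p.1 - 1)) (h0 : p ≠ (0, 0)) :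
    1 ≤ p.1 := by
  by_contra hlt
  push Not at hlt
  apply h0
  have hx : p.1 = 0 := by
    by_contra hne
    have h1 : 0 < p.1 ^ 2 := by positivity
    nlinarith [sq_nonneg p.2, mul_pos h1 (sub_pos.2 hlt)]
  have hy : p.2 = 0 := by
    rw [hx] at hp
    simpa using hp
  exact Prod.ext hx hy

theorem nodal_aux_sub {S : Set (ℝ × ℝ)} (hS : IsPreconnected S)
    (hZ : S ⊆ {p : ℝ × ℝ | p.2 ^ 2 = p.1 ^ 2 * (p.1 - 1)}) (h0 : ((0, 0) : ℝ × ℝ) ∈ S) :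
    S ⊆ {((0, 0) : ℝ × ℝ)} := by
  intro p hp
  by_contra hne
  have h1 : 1 ≤ p.1 := nodal_aux_ge (hZ hp) hne
  have hI : IsPreconnected (Set.image Prod.fst S) := hS.image _ continuous_fst.continuousOn
  obtain ⟨q, hq, hq2⟩ := hI.ordConnected.out ⟨_, h0, rfl⟩ ⟨p, hp, rfl⟩
    (show (1 / 2 : ℝ) ∈ Set.Icc 0 p.1 from ⟨by norm_num, by linarith⟩)
  have hq0 : q ≠ (0, 0) := by
    rintro rfl
    norm_num at hq2
  have := nodal_aux_ge (hZ hq) hq0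
  rw [hq2] at this
  norm_num at this

theorem nodal_aux_range :
    {p : ℝ × ℝ | p.2 ^ 2 = p.1 ^ 2 * (p.1 - 1)} \ {((0, 0) : ℝ × ℝ)} =
      Set.range (fun t : ℝ => ((t ^ 2 + 1, t * (t ^ 2 + 1)) : ℝ × ℝ)) := by
  ext ⟨x, y⟩
  constructor
  · rintro ⟨hp, hne⟩
    have h1 : 1 ≤ x := nodal_aux_ge hp hne
    have hx : x ≠ 0 := by linarith
    have hpe : y ^ 2 = x ^ 2 * (x - 1) := hp
    have ht : (y / x) ^ 2 + 1 = x := by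
      rw [div_pow, hpe]
      field_simp
      ring
    refine ⟨y / x, ?_⟩
    simp only [ht]
    rw [div_mul_cancel₀ _ hx]
  · rintro ⟨t, ht⟩
    simp only [Prod.mk.injEq] at ht
    obtain ⟨rfl, rfl⟩ := ht
    refine ⟨?_, ?_⟩
    · simp only [Set.mem_ofPred_eq]
      ring
    · intro h
      have h2 : t ^ 2 + 1 = 0 := congrArg Prod.fst h
      nlinarith [sq_nonneg t]

/-- For `Z = {(x, y) ∈ ℝ² : y² = x²(x - 1)}`: the origin lies in `Z`, the singleton
`{(0, 0)}` is a connected component of `Z`, the set `Z \ {(0, 0)}` is nonempty and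
connected and is the connected component of each of its points.  In particular `Z`
has exactly the two connected components `{(0, 0)}` and `Z \ {(0, 0)}`, so `Z` is
not connected. -/
theorem nodal_cubic_two_components :
    ((0, 0) : ℝ × ℝ) ∈ {p : ℝ × ℝ | p.2 ^ 2 = p.1 ^ 2 * (p.1 - 1)} ∧
    connectedComponentIn {p : ℝ × ℝ | p.2 ^ 2 = p.1 ^ 2 * (p.1 - 1)} ((0, 0) : ℝ × ℝ)
      = {((0, 0) : ℝ × ℝ)} ∧
    ({p : ℝ × ℝ | p.2 ^ 2 = p.1 ^ 2 * (p.1 - 1)} \ {((0, 0) : ℝ × ℝ)}).Nonempty ∧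
    IsConnected ({p : ℝ × ℝ | p.2 ^ 2 = p.1 ^ 2 * (p.1 - 1)} \ {((0, 0) : ℝ × ℝ)}) ∧
    (∀ p ∈ {p : ℝ × ℝ | p.2 ^ 2 = p.1 ^ 2 * (p.1 - 1)} \ {((0, 0) : ℝ × ℝ)},
      connectedComponentIn {p : ℝ × ℝ | p.2 ^ 2 = p.1 ^ 2 * (p.1 - 1)} p
        = {p : ℝ × ℝ | p.2 ^ 2 = p.1 ^ 2 * (p.1 - 1)} \ {((0, 0) : ℝ × ℝ)}) ∧
    ¬ IsPreconnected {p : ℝ × ℝ | p.2 ^ 2 = p.1 ^ 2 * (p.1 - 1)} := by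
  have h0 : ((0, 0) : ℝ × ℝ) ∈ {p : ℝ × ℝ | p.2 ^ 2 = p.1 ^ 2 * (p.1 - 1)} := by simp
  have hc : IsConnected
      ({p : ℝ × ℝ | p.2 ^ 2 = p.1 ^ 2 * (p.1 - 1)} \ {((0, 0) : ℝ × ℝ)}) := by
    rw [nodal_aux_range]
    exact isConnected_range (by fun_prop)
  refine ⟨h0, ?_, hc.nonempty, hc, ?_, ?_⟩
  · apply Set.Subset.antisymm
    · exact nodal_aux_sub isPreconnected_connectedComponentIn
        (connectedComponentIn_subset _ _) (mem_connectedComponentIn h0)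
    · exact Set.singleton_subset_iff.2 (mem_connectedComponentIn h0)
  · intro p hp
    apply Set.Subset.antisymm
    · intro q hq
      refine ⟨connectedComponentIn_subset _ _ hq, ?_⟩
      rintro rfl
      exact hp.2 (nodal_aux_sub isPreconnected_connectedComponentIn
        (connectedComponentIn_subset _ _) hq (mem_connectedComponentIn hp.1))
    · exact hc.isPreconnected.subset_connectedComponentIn hp Set.sdiff_subset
  · intro h
    obtain ⟨p, hp⟩ := hc.nonempty
    exact hp.2 (nodal_aux_sub h subset_rfl h0 hp.1)
end
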